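/- Let G be a graph and Γ a set of cycles of G that generates its cycle space over GF(2). Let (T, V) be a stable tree-decomposition of G and t_1t_2 an edge of T such that V_{t_1} ∩ V_{t_2} meets two distinct components of G[V_{t_1}]. Then there exists a cycle C ∈ Γ such that some connected component of C ∩ G[V_{T_2}] meets two distinct components of G[V_{t_1}]. -/

import Mathlib

open SimpleGraph

universe u

/-- `x` and `y` are joined by a walk in `G` all of whose vertices lie in `S`. -/
def ConnIn {V : Type u} (G : SimpleGraph V) (S : Set V) (x y : V) : Prop :=
  ∃ p : G.Walk x y, ∀ v ∈ p.support, v ∈ S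

/-- `S` is a (nonempty) connected vertex set of `G`, i.e. `G[S]` is connected. -/
def IsConnSet {V : Type u} (G : SimpleGraph V) (S : Set V) : Prop :=
  S.Nonempty ∧ ∀ x ∈ S, ∀ y ∈ S, ConnIn G S x y

/-- A tree-decomposition of `G` over the tree `T`. -/
structure TreeDecomp {V ι : Type u} (G : SimpleGraph V) (T : SimpleGraph ι) where
  isTree : T.IsTree
  bag : ι → Set V
  exists_bag : ∀ v : V, ∃ t, v ∈ bag t
  exists_bag_adj : ∀ ⦃u v : V⦄, G.Adj u v → ∃ t, u ∈ bag t ∧ v ∈ bag t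
  bag_sep : ∀ ⦃t₁ t₃ : ι⦄ (p : T.Walk t₁ t₃), p.IsPath → ∀ t₂ ∈ p.support,
      bag t₁ ∩ bag t₃ ⊆ bag t₂

/-- The union of the bags `B u` over `u ∈ A`. -/
def unionBags {V ι : Type u} (B : ι → Set V) (A : Set ι) : Set V := ⋃ u ∈ A, B u

/-- `s` is a descendant of `t` in the tree `T` rooted at `r`:
`t` lies on the (unique) `r`–`s` path. -/
def Desc {ι : Type u} (T : SimpleGraph ι) (r t s : ι) : Prop :=
  ∃ p : T.Walk r s, p.IsPath ∧ t ∈ p.support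

/-- The set of descendants of `t` (the subtree `T_t`). -/
def descSet {ι : Type u} (T : SimpleGraph ι) (r t : ι) : Set ι := {s | Desc T r t s}

/-- `s` is a child of `t` in the tree `T` rooted at `r`. -/
def IsChild {ι : Type u} (T : SimpleGraph ι) (r t s : ι) : Prop :=
  T.Adj t s ∧ Desc T r t s

/-- The vertex set of the component of `t₁` in `T` minus the edge `t₁t₂`. -/
def Side {ι : Type u} (T : SimpleGraph ι) (t₁ t₂ : ι) : Set ι :=
  {u | ∃ p : T.Walk u t₁, p.IsPath ∧ t₂ ∉ p.support}

/-- The family of bags `B` is stable: for every tree edge `t₁t₂`, both sides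
induce connected subgraphs of `G`. -/
def StableBags {V ι : Type u} (G : SimpleGraph V) (T : SimpleGraph ι) (B : ι → Set V) : Prop :=
  ∀ ⦃t₁ t₂ : ι⦄, T.Adj t₁ t₂ → IsConnSet G (unionBags B (Side T t₁ t₂))

def TreeDecomp.Stable {V ι : Type u} {G : SimpleGraph V} {T : SimpleGraph ι}
    (td : TreeDecomp G T) : Prop :=
  StableBags G T td.bag

/-- `P` is a `t`-admissible path (w.r.t. the root `r` and bags `B`): a shortest
path lying in `V_{T_t}` joining two distinct components of `G[B t]`. -/
structure IsAdmissible {V ι : Type u} (G : SimpleGraph V) (T : SimpleGraph ι)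
    (B : ι → Set V) (r t : ι) {x y : V} (P : G.Walk x y) : Prop where
  isPath : P.IsPath
  support_sub : ∀ v ∈ P.support, v ∈ unionBags B (descSet T r t)
  fst_mem : x ∈ B t
  snd_mem : y ∈ B t
  not_conn : ¬ ConnIn G (B t) x y
  minimal : ∀ ⦃x' y' : V⦄ (Q : G.Walk x' y'), Q.IsPath →
      (∀ v ∈ Q.support, v ∈ unionBags B (descSet T r t)) →
      x' ∈ B t → y' ∈ B t → ¬ ConnIn G (B t) x' y' → P.length ≤ Q.length

/-- The updated bags obtained by adding the path `P` as in `(*)`: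
`W_u = V_u ∪ (V(P) ∩ V_{T_u})` for descendants `u` of `t`, and `W_u = V_u` otherwise. -/
def updatedBag {V ι : Type u} (T : SimpleGraph ι) (B : ι → Set V) (r t : ι)
    {G : SimpleGraph V} {x y : V} (P : G.Walk x y) (u : ι) : Set V :=
  B u ∪ {v | Desc T r t u ∧ v ∈ P.support ∧ v ∈ unionBags B (descSet T r u)}

/-- The tree-width of `G`: the least `k` such that `G` has a tree-decomposition
all of whose bags have at most `k + 1` vertices. -/
noncomputable def treewidth {V : Type u} (G : SimpleGraph V) : ℕ :=
  sInf {k | ∃ (ι : Type u) (T : SimpleGraph ι) (td : TreeDecomp G T),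
    ∀ t, (td.bag t).ncard ≤ k + 1}

/-- A tree-decomposition is connected if every bag is a connected vertex set. -/
def TreeDecomp.IsConn {V ι : Type u} {G : SimpleGraph V} {T : SimpleGraph ι}
    (td : TreeDecomp G T) : Prop :=
  ∀ t, IsConnSet G (td.bag t)

/-- The connected tree-width of `G`. -/
noncomputable def ctw {V : Type u} (G : SimpleGraph V) : ℕ :=
  sInf {k | ∃ (ι : Type u) (T : SimpleGraph ι) (td : TreeDecomp G T),
    td.IsConn ∧ ∀ t, (td.bag t).ncard ≤ k + 1}

/-- The weak connected tree-width of `G`: the least `k` such that `G` has a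
tree-decomposition each of whose bags is contained in a connected set of at
most `k + 1` vertices. -/
noncomputable def wctw {V : Type u} (G : SimpleGraph V) : ℕ :=
  sInf {k | ∃ (ι : Type u) (T : SimpleGraph ι) (td : TreeDecomp G T),
    ∀ t, ∃ X, td.bag t ⊆ X ∧ IsConnSet G X ∧ X.ncard ≤ k + 1}

/-- The characteristic vector over GF(2) of the edge set of a walk. -/
noncomputable def walkChar {V : Type u} {G : SimpleGraph V} {x y : V}
    (p : G.Walk x y) : Sym2 V → ZMod 2 :=
  fun e => by classical exact if e ∈ p.edges then 1 else 0

/-- The characteristic vectors of the cycles of `G` of length at most `ℓ`. -/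
def cycleChars {V : Type u} (G : SimpleGraph V) (ℓ : ℕ) : Set (Sym2 V → ZMod 2) :=
  {f | ∃ (v : V) (p : G.Walk v v), p.IsCycle ∧ p.length ≤ ℓ ∧ f = walkChar p}

/-- The cycles of length at most `ℓ` generate the cycle space of `G` over GF(2). -/
def GeneratesLE {V : Type u} (G : SimpleGraph V) (ℓ : ℕ) : Prop :=
  ∀ ⦃v : V⦄ (p : G.Walk v v), p.IsCycle →
    walkChar p ∈ Submodule.span (ZMod 2) (cycleChars G ℓ)

/-- `ℓ(G)`: the least `ℓ` such that the cycles of length at most `ℓ`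
generate the cycle space of `G`. -/
noncomputable def ellGraph {V : Type u} (G : SimpleGraph V) : ℕ :=
  sInf {ℓ | GeneratesLE G ℓ}

/-- `Γ` is a set of cycles of `G` generating its cycle space over GF(2). -/
def GeneratesSet {V : Type u} (G : SimpleGraph V) (Γ : Set (Σ v : V, G.Walk v v)) : Prop :=
  (∀ c ∈ Γ, c.2.IsCycle) ∧
  ∀ ⦃v : V⦄ (p : G.Walk v v), p.IsCycle →
    walkChar p ∈ Submodule.span (ZMod 2) {f | ∃ c ∈ Γ, f = walkChar c.2}

/-- A bramble: a collection of connected vertex sets, any two of which have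
connected union. -/
def IsBramble {V : Type u} (G : SimpleGraph V) (B : Set (Set V)) : Prop :=
  (∀ S ∈ B, IsConnSet G S) ∧ ∀ S ∈ B, ∀ S' ∈ B, IsConnSet G (S ∪ S')

/-- `X` is a connected cover of the bramble `B`. -/
def IsConnCover {V : Type u} (G : SimpleGraph V) (B : Set (Set V)) (X : Set V) : Prop :=
  IsConnSet G X ∧ ∀ S ∈ B, (X ∩ S).Nonempty

/-- The connected order of a bramble: the least size of a connected cover. -/
noncomputable def connOrder {V : Type u} (G : SimpleGraph V) (B : Set (Set V)) : ℕ :=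
  sInf {n | ∃ X, IsConnCover G B X ∧ X.ncard = n}

/-- The maximum connected order of a bramble of `G`. -/
noncomputable def cbn {V : Type u} (G : SimpleGraph V) : ℕ :=
  sSup {n | ∃ B, IsBramble G B ∧ connOrder G B = n}

/-- A geodesic cycle: a cycle containing a shortest `G`-path between any two
of its vertices. -/
def IsGeodesicCycle {V : Type u} (G : SimpleGraph V) {v : V} (p : G.Walk v v) : Prop :=
  p.IsCycle ∧ ∀ x ∈ p.support, ∀ y ∈ p.support,
    ∃ q : G.Walk x y, q.length = G.dist x y ∧ ∀ e ∈ q.edges, e ∈ p.edges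

/-- The graph obtained from `K_n` by subdividing every edge exactly `k` times:
the edge between `i < j` is replaced by the path
`i, ((i,j),0), ((i,j),1), …, ((i,j),k-1), j`. -/
def subK (n k : ℕ) : SimpleGraph (Fin n ⊕ ({p : Fin n × Fin n // p.1 < p.2} × Fin k)) :=
  SimpleGraph.fromRel fun u v =>
    match u, v with
    | Sum.inl i, Sum.inl j => i < j ∧ k = 0
    | Sum.inl i, Sum.inr (e, c) =>
        (e.val.1 = i ∧ (c : ℕ) = 0) ∨ (e.val.2 = i ∧ (c : ℕ) = k - 1)
    | Sum.inr (e, c), Sum.inr (e', c') => e = e' ∧ (c' : ℕ) = (c : ℕ) + 1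
    | _, _ => False

section EdgeSums

variable {V : Type u} {G : SimpleGraph V}

/-- The indicator over GF(2) of the edge boundary of the vertex set `S`. -/
noncomputable def cutChar (S : Set V) : Sym2 V → ZMod 2 :=
  Sym2.lift ⟨fun u v => S.indicator 1 u + S.indicator 1 v, fun _ _ => add_comm _ _⟩

theorem sum_cutChar_edges (S : Set V) {u v : V} (p : G.Walk u v) :
    (p.edges.map (cutChar S)).sum = S.indicator 1 u + S.indicator 1 v := by
  induction p with
  | nil => simp [CharTwo.add_self_eq_zero]
  | @cons u v w h p ih =>
    rw [Walk.edges_cons, List.map_cons, List.sum_cons, ih]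
    simp only [cutChar, Sym2.lift_mk]
    linear_combination CharTwo.add_self_eq_zero (S.indicator (1 : V → ZMod 2) v)

theorem sum_edges_bypass [DecidableEq V] (g : Sym2 V → ZMod 2)
    (hg : ∀ ⦃v : V⦄ (p : G.Walk v v), p.IsCycle → (p.edges.map g).sum = 0)
    {u v : V} (p : G.Walk u v) :
    (p.bypass.edges.map g).sum = (p.edges.map g).sum := by
  induction p with
  | nil => rfl
  | @cons u v w h p ih =>
    rw [Walk.edges_cons, List.map_cons, List.sum_cons, ← ih, Walk.bypass]
    split_ifs with hs
    · have hpath := p.bypass_isPath.takeUntil hs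
      have hclosed : g s(u, v) + ((p.bypass.takeUntil u hs).edges.map g).sum = 0 := by
        by_cases he : s(u, v) ∈ (p.bypass.takeUntil u hs).edges
        · rw [hpath.eq_adj_toWalk_of_mem_edges (Sym2.eq_swap ▸ he)]
          simp [Sym2.eq_swap (a := v) (b := u), CharTwo.add_self_eq_zero]
        · simpa using hg _ ((Walk.cons_isCycle_iff _ h).2 ⟨hpath, he⟩)
      conv_rhs => rw [← p.bypass.take_spec hs]
      rw [Walk.edges_append, List.map_append, List.sum_append, ← add_assoc, hclosed, zero_add]
    · simp

/-- A GF(2)-weighting of the edges that vanishes on all cycles vanishes on all closed walks. -/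
theorem sum_edges_eq_zero_of_isCycle (g : Sym2 V → ZMod 2)
    (hg : ∀ ⦃v : V⦄ (p : G.Walk v v), p.IsCycle → (p.edges.map g).sum = 0)
    {v : V} (p : G.Walk v v) : (p.edges.map g).sum = 0 := by
  classical
  rw [← sum_edges_bypass g hg, Walk.eq_nil_iff_nil.2 (Walk.isPath_iff_nil.1 p.bypass_isPath)]
  rfl

theorem finite_support_walkChar {u v : V} (p : G.Walk u v) :
    (Function.support (walkChar p)).Finite := by
  refine p.edges.finite_toSet.subset fun e he => ?_
  by_contra h
  exact he (if_neg h)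

theorem finsum_walkChar_mul (g : Sym2 V → ZMod 2) {u v : V} {p : G.Walk u v} (hp : p.IsTrail) :
    ∑ᶠ e, walkChar p e * g e = (p.edges.map g).sum := by
  classical
  rw [← List.sum_toFinset g hp.edges_nodup, finsum_eq_sum_of_support_subset (s := p.edges.toFinset)]
  · refine Finset.sum_congr rfl fun e he => ?_
    simp [walkChar, List.mem_toFinset.1 he]
  · intro e he
    by_contra h
    exact he (by simp [walkChar, show e ∉ p.edges by simpa using h])

/-- A GF(2)-weighting of the edges that vanishes on a generating set of cycles vanishes on all
cycles. -/
theorem GeneratesSet.sum_edges_eq_zero {Γ : Set (Σ v : V, G.Walk v v)} (hΓ : GeneratesSet G Γ)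
    {g : Sym2 V → ZMod 2} (hg : ∀ c ∈ Γ, (c.2.edges.map g).sum = 0)
    ⦃v : V⦄ (p : G.Walk v v) (hp : p.IsCycle) : (p.edges.map g).sum = 0 := by
  have key : ∀ f ∈ Submodule.span (ZMod 2) {f | ∃ c ∈ Γ, f = walkChar c.2},
      (Function.support f).Finite ∧ ∑ᶠ e, f e * g e = 0 := by
    intro f hf
    induction hf using Submodule.span_induction with
    | mem f hf =>
      obtain ⟨c, hc, rfl⟩ := hf
      exact ⟨finite_support_walkChar _,
        (finsum_walkChar_mul g (hΓ.1 c hc).isTrail).trans (hg c hc)⟩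
    | zero => simp
    | add f₁ f₂ _ _ h₁ h₂ =>
      refine ⟨(h₁.1.union h₂.1).subset (Function.support_add _ _), ?_⟩
      simp only [Pi.add_apply, add_mul]
      rw [finsum_add_distrib, h₁.2, h₂.2, add_zero]
      · exact h₁.1.subset (Function.support_mul_subset_left _ _)
      · exact h₂.1.subset (Function.support_mul_subset_left _ _)
    | smul a f _ h =>
      refine ⟨h.1.subset (Function.support_const_smul_subset a f), ?_⟩
      simp only [Pi.smul_apply, smul_eq_mul, mul_assoc]
      rw [← mul_finsum, h.2, mul_zero]
  rw [← finsum_walkChar_mul g hp.isTrail]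
  exact (key _ (hΓ.2 p hp)).2

end EdgeSums

section ConnIn

variable {V : Type u} {G : SimpleGraph V} {S : Set V} {u v w : V}

theorem ConnIn.symm (h : ConnIn G S u v) : ConnIn G S v u := by
  obtain ⟨p, hp⟩ := h
  exact ⟨p.reverse, by simpa using hp⟩

theorem ConnIn.trans (h : ConnIn G S u v) (h' : ConnIn G S v w) : ConnIn G S u w := by
  obtain ⟨p, hp⟩ := h
  obtain ⟨q, hq⟩ := h'
  refine ⟨p.append q, fun z hz => ?_⟩
  rcases (Walk.mem_support_append_iff p q).1 hz with hz | hz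
  exacts [hp z hz, hq z hz]

theorem ConnIn.refl (hu : u ∈ S) : ConnIn G S u u := ⟨Walk.nil, by simpa using hu⟩

theorem ConnIn.right_mem (h : ConnIn G S u v) : v ∈ S :=
  h.elim fun p hp => hp v p.end_mem_support

theorem ConnIn.of_adj (h : G.Adj u v) (hu : u ∈ S) (hv : v ∈ S) : ConnIn G S u v :=
  ⟨h.toWalk, by simp [hu, hv]⟩

end ConnIn

section Sides

variable {V ι : Type u} {G : SimpleGraph V} {T : SimpleGraph ι} {t₁ t₂ : ι}

theorem mem_side_self (h : t₁ ≠ t₂) : t₁ ∈ Side T t₁ t₂ :=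
  ⟨Walk.nil, Walk.IsPath.nil, by simpa using h.symm⟩

theorem mem_side_or_mem_side (hT : T.IsTree) (h : t₁ ≠ t₂) (t : ι) :
    t ∈ Side T t₁ t₂ ∨ t ∈ Side T t₂ t₁ := by
  classical
  obtain ⟨p, hp, -⟩ := hT.existsUnique_path t t₁
  by_cases ht : t₂ ∈ p.support
  · exact .inr ⟨p.takeUntil t₂ ht, hp.takeUntil ht,
      Walk.endpoint_notMem_support_takeUntil hp ht h⟩
  · exact .inl ⟨p, hp, ht⟩

theorem mem_support_of_mem_sides (hT : T.IsTree) (hadj : T.Adj t₁ t₂) {a b : ι}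
    (ha : a ∈ Side T t₁ t₂) (hb : b ∈ Side T t₂ t₁) (p : T.Walk a b) : t₁ ∈ p.support := by
  classical
  obtain ⟨q₁, hq₁, h₂⟩ := ha
  obtain ⟨q₂, -, h₁⟩ := hb
  by_contra hp
  have hr : t₁ ∉ (p.append q₂).bypass.support := fun h => by
    rcases (Walk.mem_support_append_iff _ _).1 (Walk.support_bypass_subset_support _ h) with h | h
    exacts [hp h, h₁ h]
  have hr' := (Walk.bypass_isPath (p.append q₂)).concat hr hadj.symm
  rw [(hT.existsUnique_path a t₁).unique hq₁ hr'] at h₂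
  exact h₂ (by simp [Walk.support_concat])

theorem TreeDecomp.inter_sides_subset (td : TreeDecomp G T) (hadj : T.Adj t₁ t₂) {v : V}
    (h₁ : v ∈ unionBags td.bag (Side T t₁ t₂)) (h₂ : v ∈ unionBags td.bag (Side T t₂ t₁)) :
    v ∈ td.bag t₁ := by
  simp only [unionBags, Set.mem_iUnion, exists_prop] at h₁ h₂
  obtain ⟨a, ha, hva⟩ := h₁
  obtain ⟨b, hb, hvb⟩ := h₂
  obtain ⟨p, hp, -⟩ := td.isTree.existsUnique_path a b
  exact td.bag_sep p hp t₁ (mem_support_of_mem_sides td.isTree hadj ha hb p) ⟨hva, hvb⟩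

theorem bag_subset_unionBags (B : ι → Set V) {A : Set ι} {t : ι} (ht : t ∈ A) :
    B t ⊆ unionBags B A := Set.subset_biUnion_of_mem ht

theorem TreeDecomp.adj_mem_sides (td : TreeDecomp G T) (h : t₁ ≠ t₂) {u v : V} (huv : G.Adj u v) :
    (u ∈ unionBags td.bag (Side T t₁ t₂) ∧ v ∈ unionBags td.bag (Side T t₁ t₂)) ∨
      (u ∈ unionBags td.bag (Side T t₂ t₁) ∧ v ∈ unionBags td.bag (Side T t₂ t₁)) := by
  obtain ⟨t, hu, hv⟩ := td.exists_bag_adj huv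
  exact (mem_side_or_mem_side td.isTree h t).imp
    (fun ht => ⟨bag_subset_unionBags _ ht hu, bag_subset_unionBags _ ht hv⟩)
    (fun ht => ⟨bag_subset_unionBags _ ht hu, bag_subset_unionBags _ ht hv⟩)

end Sides

section Crossing

variable {V : Type u} {G : SimpleGraph V}

open Classical in
/-- The indicator over GF(2) of the edges of `G[B]` in the boundary of `Z`. -/
noncomputable def inducedCutChar (B Z : Set V) (e : Sym2 V) : ZMod 2 :=
  if ∀ v ∈ e, v ∈ B then cutChar Z e else 0

/-- If no component of `p ∩ G[B]` meets both the component `Z` of `x` in `G[D]` and another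
component of `G[D]`, then the closed walk `p` meets the boundary of `Z` in `G[B]` evenly. -/
theorem sum_inducedCutChar_eq_zero {A B D : Set V} (hD : A ∩ B ⊆ D)
    (hAB : ∀ ⦃u v⦄, G.Adj u v → (u ∈ A ∧ v ∈ A) ∨ (u ∈ B ∧ v ∈ B)) (x : V)
    {w : V} (p : G.Walk w w)
    (hp : ∀ (a b : V) (q : G.Walk a b), (∀ e ∈ q.edges, e ∈ p.edges) →
      (∀ v ∈ q.support, v ∈ B) → a ∈ D → b ∈ D → ConnIn G D a b) :
    (p.edges.map (inducedCutChar B {v | ConnIn G D x v})).sum = 0 := by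
  set Z : Set V := {v | ConnIn G D x v}
  set R : Set V := {v | ∃ z ∈ Z, ∃ q : G.Walk z v, (∀ e ∈ q.edges, e ∈ p.edges) ∧
    ∀ u ∈ q.support, u ∈ B}
  have hR_step : ∀ u v, s(u, v) ∈ p.edges → v ∈ B → u ∈ R → v ∈ R := by
    rintro u v he hv ⟨z, hz, q, hqe, hqB⟩
    refine ⟨z, hz, q.concat (p.adj_of_mem_edges he), fun e h => ?_, fun a h => ?_⟩
    · rw [Walk.edges_concat, List.concat_eq_append, List.mem_append, List.mem_singleton] at h
      rcases h with h | rfl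
      exacts [hqe e h, he]
    · rw [Walk.support_concat, List.mem_append, List.mem_singleton] at h
      rcases h with h | rfl
      exacts [hqB a h, hv]
  have hZR : ∀ v ∈ Z, v ∈ B → v ∈ R := fun v hv hvB =>
    ⟨v, hv, Walk.nil, by simp, by simpa using hvB⟩
  have hA : ∀ v ∈ A, v ∉ R \ Z := by
    rintro v hvA ⟨⟨z, hz, q, hqe, hqB⟩, hvZ⟩
    exact hvZ (ConnIn.trans hz
      (hp z v q hqe hqB hz.right_mem (hD ⟨hvA, hqB v q.end_mem_support⟩)))
  have heq : ∀ e ∈ p.edges, inducedCutChar B Z e = cutChar (R \ Z) e := by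
    intro e
    induction e using Sym2.ind with
    | _ u v =>
    intro he
    have he' : s(v, u) ∈ p.edges := Sym2.eq_swap ▸ he
    by_cases hB : u ∈ B ∧ v ∈ B
    · have hiff : u ∈ R ↔ v ∈ R := ⟨hR_step u v he hB.2, hR_step v u he' hB.1⟩
      have h11 : (1 + 1 : ZMod 2) = 0 := CharTwo.add_self_eq_zero 1
      rw [inducedCutChar, if_pos (by simpa using hB)]
      simp only [cutChar, Sym2.lift_mk, Set.indicator]
      by_cases huR : u ∈ R
      · have hvR := hiff.1 huR
        by_cases huZ : u ∈ Z <;> by_cases hvZ : v ∈ Z <;> simp [huR, hvR, huZ, hvZ, h11]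
      · have hvR := mt hiff.2 huR
        have huZ : u ∉ Z := fun h => huR (hZR u h hB.1)
        have hvZ : v ∉ Z := fun h => hvR (hZR v h hB.2)
        simp [huR, hvR, huZ, hvZ]
    · have := (hAB (p.adj_of_mem_edges he)).resolve_right hB
      have hu := hA u this.1
      have hv := hA v this.2
      rw [inducedCutChar, if_neg (by simpa using hB)]
      simp [cutChar, Set.indicator_of_notMem hu, Set.indicator_of_notMem hv]
  rw [List.map_congr_left heq, sum_cutChar_edges, CharTwo.add_self_eq_zero]

theorem exists_crossing_cycle {Γ : Set (Σ v : V, G.Walk v v)} (hΓ : GeneratesSet G Γ)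
    {A B D : Set V} (hD : A ∩ B ⊆ D)
    (hAB : ∀ ⦃u v⦄, G.Adj u v → (u ∈ A ∧ v ∈ A) ∨ (u ∈ B ∧ v ∈ B)) {x y : V}
    (hA : ConnIn G A x y) (hB : ConnIn G B x y) (hx : x ∈ D) (hxy : ¬ ConnIn G D x y) :
    ∃ c ∈ Γ, ∃ (a b : V) (q : G.Walk a b), (∀ e ∈ q.edges, e ∈ c.2.edges) ∧
      (∀ v ∈ q.support, v ∈ B) ∧ a ∈ D ∧ b ∈ D ∧ ¬ ConnIn G D a b := by
  by_contra! hcon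
  obtain ⟨p, hp⟩ := hA
  obtain ⟨q, hq⟩ := hB
  have hsum := sum_edges_eq_zero_of_isCycle _ (hΓ.sum_edges_eq_zero fun c hc =>
    sum_inducedCutChar_eq_zero hD hAB x c.2 (hcon c hc)) (p.append q.reverse)
  set Z : Set V := {v | ConnIn G D x v}
  have hpsum : (p.edges.map (inducedCutChar B Z)).sum = 0 := by
    refine List.sum_eq_zero fun n hn => ?_
    obtain ⟨e, he, rfl⟩ := List.mem_map.1 hn
    induction e using Sym2.ind with
    | _ u v =>
    rw [inducedCutChar]
    split_ifs with h
    · have huv := p.adj_of_mem_edges he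
      have hu : u ∈ D := hD ⟨hp u (p.fst_mem_support_of_mem_edges he), h u (by simp)⟩
      have hv : v ∈ D := hD ⟨hp v (p.snd_mem_support_of_mem_edges he), h v (by simp)⟩
      have hiff : u ∈ Z ↔ v ∈ Z :=
        ⟨fun h => ConnIn.trans h (.of_adj huv hu hv),
          fun h => ConnIn.trans h (.of_adj huv.symm hv hu)⟩
      by_cases hvZ : v ∈ Z <;>
        simp [cutChar, Set.indicator, hiff, hvZ, CharTwo.add_self_eq_zero]
    · rfl
  have hqsum : (q.edges.map (inducedCutChar B Z)).sum = 1 := by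
    have heq : ∀ e ∈ q.edges, inducedCutChar B Z e = cutChar Z e := fun e he =>
      if_pos fun v hv => hq v (Walk.mem_support_of_mem_edges he hv)
    have hxZ : x ∈ Z := ConnIn.refl hx
    have hyZ : y ∉ Z := hxy
    rw [List.map_congr_left heq, sum_cutChar_edges, Set.indicator_of_mem hxZ,
      Set.indicator_of_notMem hyZ, Pi.one_apply, add_zero]
  rw [Walk.edges_append, Walk.edges_reverse, List.map_append, List.sum_append, List.map_reverse,
    List.sum_reverse, hpsum, hqsum] at hsum
  simp at hsum

end Crossing

/-- if `Γ` generates the cycle space, `(T, V)` is stable and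
`V_{t₁} ∩ V_{t₂}` meets two distinct components of `G[V_{t₁}]`, then some
cycle `C ∈ Γ` has a component of `C ∩ G[V_{T₂}]` meeting two distinct
components of `G[V_{t₁}]`. -/
theorem cycle_crossing {V ι : Type u} (G : SimpleGraph V)
    (Γ : Set (Σ v : V, G.Walk v v)) (hΓ : GeneratesSet G Γ)
    (T : SimpleGraph ι) (td : TreeDecomp G T) (hst : td.Stable)
    {t₁ t₂ : ι} (hadj : T.Adj t₁ t₂) (x y : V)
    (hx : x ∈ td.bag t₁ ∩ td.bag t₂) (hy : y ∈ td.bag t₁ ∩ td.bag t₂)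
    (hxy : ¬ ConnIn G (td.bag t₁) x y) :
    ∃ c ∈ Γ, ∃ (a b : V) (q : G.Walk a b),
      (∀ e ∈ q.edges, e ∈ c.2.edges) ∧
      (∀ v ∈ q.support, v ∈ unionBags td.bag (Side T t₂ t₁)) ∧
      a ∈ td.bag t₁ ∧ b ∈ td.bag t₁ ∧ ¬ ConnIn G (td.bag t₁) a b := by
  have h₁ := mem_side_self (T := T) hadj.ne
  have h₂ := mem_side_self (T := T) hadj.ne'
  exact exists_crossing_cycle hΓ (fun v hv => td.inter_sides_subset hadj hv.1 hv.2)
    (fun u v huv => td.adj_mem_sides hadj.ne huv)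
    ((hst hadj).2 x (bag_subset_unionBags _ h₁ hx.1) y (bag_subset_unionBags _ h₁ hy.1))
    ((hst hadj.symm).2 x (bag_subset_unionBags _ h₂ hx.2) y (bag_subset_unionBags _ h₂ hy.2))
    hx.1 hxy
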